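/- Let Λ be a nonempty finite set, let 0 < p < 1, and let μ_p be the probability distribution on binary masks m : Λ → {0,1} given by μ_p(m) = ∏_{κ∈Λ} p^{m(κ)}(1−p)^{1−m(κ)} (each pixel is retained independently with probability p). Fix λ ∈ Λ and let F_λ(m) denote the mask equal to m except that its value at λ is flipped. If f : ({0,1}^Λ) → ℝ satisfies f(m) = f(F_λ(m)) for every mask m, then the debiased saliency S^PN(λ) := E_{m∼μ_p}[f(m) | m(λ)=1] − E_{m∼μ_p}[f(m) | m(λ)=0] equals 0. -/

import Mathlib

open Finset

/-- The RISE mask distribution: each pixel retained (value 1) independently with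
probability `p`, i.e. `μ_p(m) = ∏_κ p^{m(κ)} (1-p)^{1-m(κ)}`. -/
noncomputable def muMask {Λ : Type*} [Fintype Λ] (p : ℝ) (m : Λ → Fin 2) : ℝ :=
  ∏ κ, p ^ (m κ : ℕ) * (1 - p) ^ (1 - (m κ : ℕ))

/-- Conditional expectation of `f` w.r.t. the weight function `μ`, given the event `P`. -/
noncomputable def condExp {α : Type*} [Fintype α] (μ : α → ℝ) (f : α → ℝ)
    (P : α → Prop) [DecidablePred P] : ℝ :=
  (∑ x ∈ univ.filter P, f x * μ x) / (∑ x ∈ univ.filter P, μ x)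

/-- The map flipping the value of a binary mask at the pixel `l0`. -/
def flipAt {Λ : Type*} [DecidableEq Λ] (l0 : Λ) (m : Λ → Fin 2) : Λ → Fin 2 :=
  fun κ => if κ = l0 then 1 - m l0 else m κ

/-- The debiased saliency `S^PN(λ) = E[f | m(λ)=1] − E[f | m(λ)=0]`. -/
noncomputable def SPN {Λ : Type*} [Fintype Λ] [DecidableEq Λ]
    (p : ℝ) (f : (Λ → Fin 2) → ℝ) (l0 : Λ) : ℝ :=
  condExp (muMask p) f (fun m => m l0 = 1) - condExp (muMask p) f (fun m => m l0 = 0)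

theorem flipAt_flipAt {Λ : Type*} [DecidableEq Λ] (l0 : Λ) (m : Λ → Fin 2) :
    flipAt l0 (flipAt l0 m) = m := by
  funext κ
  by_cases h : κ = l0 <;> simp [flipAt, h]

/-- Clearing a retained pixel multiplies the weight of a mask by `(1 - p) / p`. -/
theorem mul_muMask_flipAt {Λ : Type*} [Fintype Λ] [DecidableEq Λ] (p : ℝ) {l0 : Λ}
    {m : Λ → Fin 2} (hm : m l0 = 1) :
    p * muMask p (flipAt l0 m) = (1 - p) * muMask p m := by
  have hrest : ∏ κ ∈ univ.erase l0,
        p ^ (flipAt l0 m κ : ℕ) * (1 - p) ^ (1 - (flipAt l0 m κ : ℕ)) =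
      ∏ κ ∈ univ.erase l0, p ^ (m κ : ℕ) * (1 - p) ^ (1 - (m κ : ℕ)) :=
    prod_congr rfl fun κ hκ => by simp [flipAt, ne_of_mem_erase hκ]
  have hflip : flipAt l0 m l0 = 0 := by simp [flipAt, hm]
  unfold muMask
  rw [← mul_prod_erase univ _ (mem_univ l0), ← mul_prod_erase univ _ (mem_univ l0), hrest,
    hflip, hm]
  simp only [Fin.val_zero, Fin.val_one]
  ring

theorem mul_sum_muMask_of_flip_invariant {Λ : Type*} [Fintype Λ] [DecidableEq Λ] (p : ℝ)
    (l0 : Λ) (g : (Λ → Fin 2) → ℝ) (hg : ∀ m, g m = g (flipAt l0 m)) :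
    (1 - p) * ∑ m ∈ univ.filter (fun m : Λ → Fin 2 => m l0 = 1), g m * muMask p m =
      p * ∑ m ∈ univ.filter (fun m : Λ → Fin 2 => m l0 = 0), g m * muMask p m := by
  rw [mul_sum, mul_sum]
  refine sum_bij' (fun m _ => flipAt l0 m) (fun m _ => flipAt l0 m) ?_ ?_
    (fun m _ => flipAt_flipAt l0 m) (fun m _ => flipAt_flipAt l0 m) ?_
  · intro m hm
    simp_all [flipAt]
  · intro m hm
    simp_all [flipAt]
  · intro m hm
    rw [← hg m, mul_left_comm, ← mul_muMask_flipAt p (mem_filter.mp hm).2, mul_left_comm]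

/-- Proposition 1 (irrelevant pixels): if the confidence `f` is invariant under flipping
the mask bit at `l0`, then the debiased saliency at `l0` vanishes. -/
theorem spn_eq_zero_of_flip_invariant {Λ : Type*} [Fintype Λ] [DecidableEq Λ] [Nonempty Λ]
    (p : ℝ) (hp0 : 0 < p) (hp1 : p < 1) (l0 : Λ)
    (f : (Λ → Fin 2) → ℝ) (hf : ∀ m, f m = f (flipAt l0 m)) :
    SPN p f l0 = 0 := by
  have hnum := mul_sum_muMask_of_flip_invariant p l0 f hf
  have hden := mul_sum_muMask_of_flip_invariant p l0 (fun _ => 1) fun _ => rfl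
  simp only [one_mul] at hden
  rw [SPN, condExp, condExp, sub_eq_zero, ← mul_div_mul_left _ _ (sub_pos.mpr hp1).ne',
    hnum, hden, mul_div_mul_left _ _ hp0.ne']
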